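/- Let μ be a σ-finite measure with μ(T) > 0, let φ be a continuously differentiable deformed exponential, let u₀ : T → (0,∞) satisfy condition (C), and let p, q ∈ P_μ. Let κ : (0,1) → [0,∞) be the function determined by ∫_T φ(α·φ⁻¹(p) + (1−α)·φ⁻¹(q) + κ(α)·u₀) dμ = 1 for each α ∈ (0,1). If there exists α₀ > 1 such that ∫_T φ(α·φ⁻¹(p) + (1−α)·φ⁻¹(q)) dμ < ∞ for all α ∈ (1, α₀], then the limit D_φ^{(1)}(p‖q) := lim_{α↑1} κ(α)/(α(1−α)) exists, is finite, and equals the φ-divergence D_φ(p‖q) = (∫_T (φ⁻¹(p) − φ⁻¹(q))/(φ⁻¹)'(p) dμ) / (∫_T u₀/(φ⁻¹)'(p) dμ). -/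

import Mathlib

open MeasureTheory Filter Set

lemma aux_tangent {φ : ℝ → ℝ} (hconv : ConvexOn ℝ Set.univ φ) (hd : Differentiable ℝ φ)
    (x y : ℝ) : φ x + deriv φ x * (y - x) ≤ φ y := by
  rcases lt_trichotomy x y with h | h | h
  · have := hconv.le_slope_of_hasDerivAt (mem_univ x) (mem_univ y) h (hd x).hasDerivAt
    rw [slope_def_field, le_div_iff₀ (by linarith)] at this
    linarith
  · subst h; simp
  · have := hconv.slope_le_of_hasDerivAt (mem_univ y) (mem_univ x) h (hd x).hasDerivAt
    rw [slope_def_field, div_le_iff₀ (by linarith)] at this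
    linarith

lemma aux_mono {φ : ℝ → ℝ} (hconv : ConvexOn ℝ Set.univ φ) (hd : Differentiable ℝ φ)
    (hnonneg : ∀ u, 0 ≤ φ u) (hbot : Tendsto φ atBot (nhds 0)) : Monotone φ := by
  refine monotone_of_deriv_nonneg hd fun x => ?_
  by_contra! hx
  obtain ⟨y, hy1, hy2⟩ := ((hbot.eventually (gt_mem_nhds (show (0:ℝ) < - deriv φ x by linarith))).and
    (eventually_le_atBot (x - 1))).exists
  have := aux_tangent hconv hd x y
  have := hnonneg x
  nlinarith

lemma aux_deriv_pos {φ : ℝ → ℝ} (hconv : ConvexOn ℝ Set.univ φ) (hd : Differentiable ℝ φ)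
    (hbot : Tendsto φ atBot (nhds 0)) (x : ℝ) (hx : 0 < φ x) :
    0 < deriv φ x := by
  obtain ⟨y, hy1, hy2⟩ := ((hbot.eventually (gt_mem_nhds hx)).and
    (eventually_le_atBot (x - 1))).exists
  have := aux_tangent hconv hd x y
  by_contra! h
  nlinarith

lemma aux_inv {φ : ℝ → ℝ} (hconv : ConvexOn ℝ Set.univ φ)
    (hbot : Tendsto φ atBot (nhds 0)) (hsmooth : ContDiff ℝ 1 φ)
    (φinv : ℝ → ℝ) (hinv₁ : ∀ v : ℝ, 0 < v → φ (φinv v) = v)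
    (hinv₂ : ∀ u : ℝ, 0 < φ u → φinv (φ u) = u) (v : ℝ) (hv : 0 < v) :
    HasDerivAt φinv (deriv φ (φinv v))⁻¹ v := by
  have hd : Differentiable ℝ φ := hsmooth.differentiable (by norm_num)
  have hpos : 0 < φ (φinv v) := by rw [hinv₁ v hv]; exact hv
  have h1 : HasStrictDerivAt φ (deriv φ (φinv v)) (φinv v) :=
    hsmooth.contDiffAt.hasStrictDerivAt (by norm_num)
  have h2 := h1.to_local_left_inverse (g := φinv)
    (aux_deriv_pos hconv hd hbot _ hpos).ne'
    (((hd.continuous.tendsto (φinv v)).eventually (lt_mem_nhds hpos)).mono fun x hx => hinv₂ x hx)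
  rw [hinv₁ v hv] at h2
  exact h2.hasDerivAt

lemma aux_core {T : Type*} [MeasurableSpace T] (μ : Measure T)
    (hμpos : μ ≠ 0)
    (φ : ℝ → ℝ) (hconv : ConvexOn ℝ Set.univ φ) (hnonneg : ∀ u, 0 ≤ φ u)
    (hd : Differentiable ℝ φ) (hmono : Monotone φ) (a d u : T → ℝ)
    (ha : Measurable a) (hdm : Measurable d) (hu : Measurable u) (hupos : ∀ t, 0 < u t)
    (hda : ∀ᵐ t ∂μ, 0 < deriv φ (a t))
    (hia : Integrable (fun t => φ (a t)) μ) (hia1 : ∫ t, φ (a t) ∂μ = 1)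
    (hib : ∀ M : ℝ, 0 ≤ M → Integrable (fun t => φ (a t + (d t + M * u t))) μ)
    (hiu : Integrable (fun t => φ (a t + u t)) μ)
    (δ : ℝ) (hδ : 0 < δ) (hiδ : Integrable (fun t => φ (a t - δ * d t)) μ)
    (k : ℝ → ℝ)
    (hk : ∀ ε ∈ Set.Ioo (0 : ℝ) 1, 0 ≤ k ε ∧ Integrable (fun t => φ (a t + (ε * d t + k ε * u t))) μ
      ∧ ∫ t, φ (a t + (ε * d t + k ε * u t)) ∂μ = 1) :
    Tendsto (fun ε => k ε / ε) (nhdsWithin 0 (Set.Ioi 0))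
      (nhds (- (∫ t, d t * deriv φ (a t) ∂μ) / (∫ t, u t * deriv φ (a t) ∂μ))) := by
  have tan : ∀ x w : ℝ, w * deriv φ x ≤ φ (x + w) - φ x := fun x w => by
    have := aux_tangent hconv hd x (x + w)
    rw [add_sub_cancel_left] at this; linarith
  have hφ : Measurable φ := hd.continuous.measurable
  have hφ' : Measurable (deriv φ) := measurable_deriv φ
  have hd0 : ∀ x, 0 ≤ deriv φ x := fun x => hmono.deriv_nonneg
  have iU : Integrable (fun t => u t * deriv φ (a t)) μ := by
    refine (hiu.sub hia).mono' (by fun_prop) (ae_of_all _ fun t => ?_)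
    rw [Real.norm_of_nonneg (mul_nonneg (hupos t).le (hd0 _))]
    exact tan _ _
  have iD : Integrable (fun t => d t * deriv φ (a t)) μ := by
    have h0 := hib 0 le_rfl
    refine ((h0.sub hia).norm.add ((hiδ.sub hia).norm.div_const δ)).mono' (by fun_prop)
      (ae_of_all _ fun t => ?_)
    have h1 := tan (a t) (d t)
    have h2 := tan (a t) (-(δ * d t))
    simp only [Pi.add_apply, Pi.sub_apply, Real.norm_eq_abs, zero_mul, add_zero]
    rw [← sub_eq_add_neg] at h2
    have h3 : -(d t * deriv φ (a t)) ≤ |φ (a t - δ * d t) - φ (a t)| / δ := by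
      rw [le_div_iff₀ hδ]
      have := le_abs_self (φ (a t - δ * d t) - φ (a t))
      linarith
    have h4 := le_abs_self (φ (a t + d t) - φ (a t))
    have h5 := abs_nonneg (φ (a t + d t) - φ (a t))
    have h6 : 0 ≤ |φ (a t - δ * d t) - φ (a t)| / δ := by positivity
    rw [abs_le]; constructor <;> linarith
  set D := ∫ t, d t * deriv φ (a t) ∂μ with hD
  set U := ∫ t, u t * deriv φ (a t) ∂μ with hU
  have Upos : 0 < U := by
    rw [hU, integral_pos_iff_support_of_nonneg_ae
      (ae_of_all _ fun t => mul_nonneg (hupos t).le (hd0 _)) iU]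
    have : (Function.support fun t => u t * deriv φ (a t)) =ᵐ[μ] Set.univ := by
      rw [eventuallyEq_univ]
      filter_upwards [hda] with t ht
      exact (mul_pos (hupos t) ht).ne'
    rw [measure_congr this]
    exact Measure.measure_univ_pos.2 hμpos
  have hE : ∀ᶠ ε in nhdsWithin (0:ℝ) (Set.Ioi 0), ε ∈ Set.Ioo (0:ℝ) 1 :=
    Ioo_mem_nhdsGT one_pos
  have upper : ∀ ε ∈ Set.Ioo (0 : ℝ) 1, k ε / ε ≤ -D / U := by
    intro ε hε
    obtain ⟨k0, k1, k2⟩ := hk ε hε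
    have h1 : ∫ t, (ε * (d t * deriv φ (a t)) + k ε * (u t * deriv φ (a t))) ∂μ
        ≤ ∫ t, (φ (a t + (ε * d t + k ε * u t)) - φ (a t)) ∂μ := by
      refine integral_mono ((iD.const_mul _).add (iU.const_mul _)) (k1.sub hia) fun t => ?_
      have := tan (a t) (ε * d t + k ε * u t)
      simp only; linarith
    rw [integral_add (iD.const_mul _) (iU.const_mul _), integral_const_mul, integral_const_mul,
      integral_sub k1 hia, k2, hia1, ← hD, ← hU] at h1
    rw [div_le_div_iff₀ hε.1 Upos]
    linarith
  refine tendsto_order.2 ⟨fun M hM => ?_, fun M hM => ?_⟩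
  · rcases lt_or_ge M 0 with hM0 | hM0
    · filter_upwards [hE] with ε hε
      exact hM0.trans_le (div_nonneg (hk ε hε).1 hε.1.le)
    · set w : T → ℝ := fun t => d t + M * u t with hw
      have hwm : Measurable w := by fun_prop
      have iw : Integrable (fun t => φ (a t + w t)) μ := hib M hM0
      have iW : Integrable (fun t => w t * deriv φ (a t)) μ := by
        refine (iD.add (iU.const_mul M)).congr (ae_of_all _ fun t => ?_)
        simp only [hw, Pi.add_apply]; ring
      have hWneg : ∫ t, w t * deriv φ (a t) ∂μ < 0 := by
        have : ∫ t, w t * deriv φ (a t) ∂μ = D + M * U := by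
          rw [hD, hU, ← integral_const_mul, ← integral_add iD (iU.const_mul M)]
          congr 1; ext t; simp only [hw]; ring
        rw [this]
        rw [lt_div_iff₀ Upos] at hM; linarith
      have cvx : ∀ ε ∈ Set.Ioo (0 : ℝ) 1, ∀ t,
          φ (a t + ε * w t) - φ (a t) ≤ ε * (φ (a t + w t) - φ (a t)) := by
        intro ε hε t
        have := hconv.2 (mem_univ (a t)) (mem_univ (a t + w t)) (sub_nonneg.2 hε.2.le) hε.1.le
          (by ring)
        simp only [smul_eq_mul] at this
        rw [show (1 - ε) * a t + ε * (a t + w t) = a t + ε * w t by ring] at this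
        linarith
      have iG : ∀ ε ∈ Set.Ioo (0 : ℝ) 1, Integrable (fun t => φ (a t + ε * w t)) μ := by
        intro ε hε
        refine (hia.add ((iw.sub hia).const_mul ε)).mono'
          (hφ.comp (ha.add (hwm.const_mul ε))).aestronglyMeasurable (ae_of_all _ fun t => ?_)
        rw [Real.norm_of_nonneg (hnonneg _)]
        have := cvx ε hε t
        simp only [Pi.add_apply, Pi.sub_apply]; linarith
      have lim : Tendsto (fun ε : ℝ => ∫ t, (φ (a t + ε * w t) - φ (a t)) / ε ∂μ)
          (nhdsWithin 0 (Set.Ioi 0)) (nhds (∫ t, w t * deriv φ (a t) ∂μ)) := by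
        refine tendsto_integral_filter_of_dominated_convergence
          (fun t => |w t * deriv φ (a t)| + |φ (a t + w t) - φ (a t)|)
          (Eventually.of_forall fun ε => by fun_prop) ?_ (iW.abs.add (iw.sub hia).abs) ?_
        · filter_upwards [hE] with ε hε
          refine ae_of_all _ fun t => ?_
          have h1 : (φ (a t + ε * w t) - φ (a t)) / ε ≤ φ (a t + w t) - φ (a t) := by
            rw [div_le_iff₀ hε.1]; have := cvx ε hε t; linarith
          have h2 : w t * deriv φ (a t) ≤ (φ (a t + ε * w t) - φ (a t)) / ε := by
            rw [le_div_iff₀ hε.1]; have := tan (a t) (ε * w t); linarith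
          have h3 := le_abs_self (φ (a t + w t) - φ (a t))
          have h4 := neg_abs_le (w t * deriv φ (a t))
          have h5 := abs_nonneg (φ (a t + w t) - φ (a t))
          have h6 := abs_nonneg (w t * deriv φ (a t))
          rw [Real.norm_eq_abs, abs_le]; constructor <;> linarith
        · refine ae_of_all _ fun t => ?_
          have h1 : HasDerivAt (fun ε : ℝ => φ (a t + ε * w t)) (deriv φ (a t) * w t) 0 := by
            have h2 : HasDerivAt (fun ε : ℝ => a t + ε * w t) (w t) 0 := by
              simpa using ((hasDerivAt_id (0:ℝ)).mul_const (w t)).const_add (a t)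
            have h3 : HasDerivAt φ (deriv φ (a t)) (a t + 0 * w t) := by
              simpa using (hd (a t)).hasDerivAt
            exact h3.comp (0:ℝ) h2
          have h2 := (hasDerivAt_iff_tendsto_slope.1 h1).mono_left
            (nhdsWithin_mono 0 (fun x (hx : (0:ℝ) < x) => hx.ne'))
          rw [mul_comm] at h2
          refine h2.congr fun ε => ?_
          simp [slope_def_field]
      filter_upwards [hE, lim.eventually (gt_mem_nhds hWneg)] with ε hε hlt
      obtain ⟨k0, k1, k2⟩ := hk ε hε
      by_contra! hle
      rw [div_le_iff₀ hε.1] at hle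
      have h1 : (1:ℝ) ≤ ∫ t, φ (a t + ε * w t) ∂μ := by
        rw [← k2]
        refine integral_mono k1 (iG ε hε) fun t => hmono ?_
        have := mul_le_mul_of_nonneg_right hle (hupos t).le
        simp only [hw]; linarith
      rw [integral_div, integral_sub (iG ε hε) hia, hia1] at hlt
      have : 0 ≤ ((∫ t, φ (a t + ε * w t) ∂μ) - 1) / ε := div_nonneg (by linarith) hε.1.le
      linarith
  · filter_upwards [hE] with ε hε
    exact (upper ε hε).trans_lt hM

/-- With `μ` σ-finite, `μ(T) > 0`, `φ` a continuously differentiable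
deformed exponential with inverse `φinv`, `u₀` satisfying condition (C), `p, q ∈ P_μ`,
and `κ : (0,1) → [0,∞)` determined by
`∫ φ(α φ⁻¹(p) + (1−α) φ⁻¹(q) + κ(α) u₀) dμ = 1`: if there is `α₀ > 1` such that
`∫ φ(α φ⁻¹(p) + (1−α) φ⁻¹(q)) dμ < ∞` for all `α ∈ (1, α₀]`, then
`lim_{α↑1} κ(α)/(α(1−α))` exists, is finite, and equals
`D_φ(p‖q) = (∫ (φ⁻¹(p) − φ⁻¹(q))/(φ⁻¹)'(p) dμ) / (∫ u₀/(φ⁻¹)'(p) dμ)`. -/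
theorem renyi_limit_at_one
    {T : Type*} [MeasurableSpace T] (μ : Measure T) [SigmaFinite μ]
    (hμpos : 0 < μ Set.univ)
    (φ : ℝ → ℝ) (hconv : ConvexOn ℝ Set.univ φ) (hnonneg : ∀ u, 0 ≤ φ u)
    (hbot : Tendsto φ atBot (nhds 0)) (htop : Tendsto φ atTop atTop)
    (hsmooth : ContDiff ℝ 1 φ)
    (φinv : ℝ → ℝ) (hinv₁ : ∀ v : ℝ, 0 < v → φ (φinv v) = v)
    (hinv₂ : ∀ u : ℝ, 0 < φ u → φinv (φ u) = u)
    (u₀ : T → ℝ) (hu₀meas : Measurable u₀) (hu₀pos : ∀ t, 0 < u₀ t)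
    (hC : ∀ c : T → ℝ, Measurable c →
      (∫⁻ t, ENNReal.ofReal (φ (c t)) ∂μ < ⊤) →
      ∀ lam : ℝ, 0 < lam → ∫⁻ t, ENNReal.ofReal (φ (c t + lam * u₀ t)) ∂μ < ⊤)
    (p : T → ℝ) (hpmeas : Measurable p) (hppos : ∀ᵐ t ∂μ, 0 < p t)
    (hpint : ∫⁻ t, ENNReal.ofReal (p t) ∂μ = 1)
    (q : T → ℝ) (hqmeas : Measurable q) (hqpos : ∀ᵐ t ∂μ, 0 < q t)
    (hqint : ∫⁻ t, ENNReal.ofReal (q t) ∂μ = 1)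
    (κ : ℝ → ℝ)
    (hκ : ∀ α ∈ Set.Ioo (0 : ℝ) 1, 0 ≤ κ α ∧
      ∫⁻ t, ENNReal.ofReal
        (φ (α * φinv (p t) + (1 - α) * φinv (q t) + κ α * u₀ t)) ∂μ = 1)
    (α₀ : ℝ) (hα₀ : 1 < α₀)
    (hfin : ∀ α : ℝ, 1 < α → α ≤ α₀ →
      ∫⁻ t, ENNReal.ofReal (φ (α * φinv (p t) + (1 - α) * φinv (q t))) ∂μ < ⊤) :
    Tendsto (fun α : ℝ => κ α / (α * (1 - α))) (nhdsWithin 1 (Set.Iio 1))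
      (nhds ((∫ t, (φinv (p t) - φinv (q t)) / deriv φinv (p t) ∂μ) /
             (∫ t, u₀ t / deriv φinv (p t) ∂μ))) := by
  have hd : Differentiable ℝ φ := hsmooth.differentiable (by norm_num)
  have hmono := aux_mono hconv hd hnonneg hbot
  have hφ : Measurable φ := hd.continuous.measurable
  have hder := aux_inv hconv hbot hsmooth φinv hinv₁ hinv₂
  set g : ℝ → ℝ := (Set.Ioi (0:ℝ)).piecewise φinv (fun _ => 0) with hg
  have hgm : Measurable g := by
    refine ContinuousOn.measurable_piecewise (fun v hv => ?_) continuousOn_const measurableSet_Ioi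
    exact (hder v hv).continuousAt.continuousWithinAt
  have hgv : ∀ v, 0 < v → g v = φinv v := fun v hv => Set.piecewise_eq_of_mem _ _ _ hv
  set a : T → ℝ := fun t => g (p t) with ha
  set d : T → ℝ := fun t => g (q t) - g (p t) with hdd
  have ham : Measurable a := hgm.comp hpmeas
  have hdm : Measurable d := (hgm.comp hqmeas).sub ham
  have key : ∀ (c : T → ℝ), Measurable c → ∫⁻ t, ENNReal.ofReal (φ (c t)) ∂μ < ⊤ →
      Integrable (fun t => φ (c t)) μ := fun c hc h =>
    (lintegral_ofReal_ne_top_iff_integrable (hφ.comp hc).aestronglyMeasurable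
      (ae_of_all _ fun t => hnonneg _)).1 h.ne
  have key1 : ∀ (c : T → ℝ), Measurable c → ∫⁻ t, ENNReal.ofReal (φ (c t)) ∂μ = 1 →
      ∫ t, φ (c t) ∂μ = 1 := fun c hc h => by
    rw [integral_eq_lintegral_of_nonneg_ae (ae_of_all _ fun t => hnonneg _)
      (hφ.comp hc).aestronglyMeasurable, h]; simp
  have la : ∫⁻ t, ENNReal.ofReal (φ (a t)) ∂μ = 1 := by
    rw [← hpint]
    refine lintegral_congr_ae ?_
    filter_upwards [hppos] with t ht
    simp only [ha]; rw [hgv _ ht, hinv₁ _ ht]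
  have lb : ∫⁻ t, ENNReal.ofReal (φ (a t + d t)) ∂μ = 1 := by
    rw [← hqint]
    refine lintegral_congr_ae ?_
    filter_upwards [hqpos] with t ht
    simp only [ha, hdd]; rw [add_sub_cancel, hgv _ ht, hinv₁ _ ht]
  have lu := hC a ham (by rw [la]; simp) 1 one_pos
  have core := aux_core μ (Measure.measure_univ_pos.1 hμpos) φ hconv hnonneg hd hmono a d u₀
    ham hdm hu₀meas hu₀pos ?_ (key a ham (by rw [la]; simp)) (key1 a ham la) ?_
    (key (fun t => a t + u₀ t) (by fun_prop) (by simpa using lu)) (α₀ - 1) (by linarith) ?_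
    (fun ε => κ (1 - ε)) ?_
  · have hlim : Tendsto (fun α : ℝ => 1 - α) (nhdsWithin 1 (Set.Iio 1))
        (nhdsWithin 0 (Set.Ioi 0)) := by
      refine tendsto_nhdsWithin_iff.2 ⟨?_, ?_⟩
      · have : Tendsto (fun α : ℝ => 1 - α) (nhds 1) (nhds (1 - 1)) :=
          (continuous_const.sub continuous_id).tendsto 1
        rw [sub_self] at this
        exact this.mono_left nhdsWithin_le_nhds
      · filter_upwards [self_mem_nhdsWithin] with α hα
        have : α < 1 := hα
        exact Set.mem_Ioi.2 (by linarith)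
    have h1 := core.comp hlim
    have h2 : Tendsto (fun α : ℝ => α⁻¹) (nhdsWithin 1 (Set.Iio 1)) (nhds 1) := by
      have := (tendsto_inv₀ (one_ne_zero (α := ℝ)))
      rw [inv_one] at this
      exact this.mono_left nhdsWithin_le_nhds
    have h3 := h1.mul h2
    rw [mul_one, ← integral_neg] at h3
    have e1 : ∫ t, (φinv (p t) - φinv (q t)) / deriv φinv (p t) ∂μ
        = ∫ t, -(d t * deriv φ (a t)) ∂μ := by
      refine integral_congr_ae ?_
      filter_upwards [hppos, hqpos] with t ht hq
      simp only [ha, hdd]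
      rw [(hder _ ht).deriv, hgv _ ht, hgv _ hq, div_inv_eq_mul]; ring
    have e2 : ∫ t, u₀ t / deriv φinv (p t) ∂μ = ∫ t, u₀ t * deriv φ (a t) ∂μ := by
      refine integral_congr_ae ?_
      filter_upwards [hppos] with t ht
      simp only [ha]
      rw [(hder _ ht).deriv, hgv _ ht, div_inv_eq_mul]
    rw [e1, e2]
    refine h3.congr fun α => ?_
    simp only [Function.comp, sub_sub_cancel]
    rw [div_mul_eq_div_div, div_right_comm, div_eq_mul_inv _ α]
  · filter_upwards [hppos] with t ht
    refine aux_deriv_pos hconv hd hbot _ ?_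
    simp only [ha]; rw [hgv _ ht, hinv₁ _ ht]; exact ht
  · intro M hM
    refine key (fun t => a t + (d t + M * u₀ t)) (by fun_prop) ?_
    rcases hM.eq_or_lt with h | h
    · subst h; simp [lb]
    · have := hC (fun t => a t + d t) (by fun_prop) (by rw [lb]; simp) M h
      simpa only [add_assoc] using this
  · refine key (fun t => a t - (α₀ - 1) * d t) (by fun_prop) ?_
    refine lt_of_eq_of_lt (lintegral_congr_ae ?_) (hfin α₀ hα₀ le_rfl)
    filter_upwards [hppos, hqpos] with t ht hq
    simp only [ha, hdd]
    rw [hgv _ ht, hgv _ hq]; congr 2; ring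
  · intro ε hε
    obtain ⟨k0, k1⟩ := hκ (1 - ε) ⟨by linarith [hε.2], by linarith [hε.1]⟩
    have k2 : ∫⁻ t, ENNReal.ofReal (φ (a t + (ε * d t + κ (1 - ε) * u₀ t))) ∂μ = 1 := by
      rw [← k1]
      refine lintegral_congr_ae ?_
      filter_upwards [hppos, hqpos] with t ht hq
      simp only [ha, hdd]
      rw [hgv _ ht, hgv _ hq]; congr 2; ring
    have hm : Measurable fun t => a t + (ε * d t + κ (1 - ε) * u₀ t) := by fun_prop
    exact ⟨k0, key _ hm (by rw [k2]; simp), key1 _ hm k2⟩
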